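/- arXiv:2201.01648 — 3 statements merged into one kernel-verified Lean document; each statement's English description precedes it below -/
import Mathlib

section
/- Let n ≥ 4 and let 𝔫_ℂ be the real Lie algebra of strictly upper triangular n×n complex matrices, with bracket [A,B] = AB − BA and grading by superdiagonals V_i = {A ∈ 𝔫_ℂ : A_{jk} = 0 whenever k − j ≠ i}. Let φ : 𝔫_ℂ → 𝔫_ℂ be a graded automorphism, i.e. an ℝ-linear Lie algebra automorphism with φ(V_i) = V_i for all i. Then there exist ε₁, ε₂ ∈ {0,1} and an invertible diagonal complex matrix g = diag(λ₁,…,λₙ) such that φ = τ^{ε₁} ∘ C^{ε₂} ∘ Ad_g, where Ad_g(A) = g A g⁻¹, C is entrywise complex conjugation, τ is defined by (τ(A))_{i,j} = −conj(A_{n−j+1, n−i+1}), and τ⁰ = C⁰ = id. -/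
/-- The real Lie algebra `𝔫_ℂ` of strictly upper triangular `n×n` complex
matrices, as a real submodule. -/
noncomputable def strictlyUpperC (n : ℕ) : Submodule ℝ (Matrix (Fin n) (Fin n) ℂ) where
  carrier := {A | ∀ i j : Fin n, j ≤ i → A i j = 0}
  add_mem' := fun ha hb i j h => by
    simp only [Matrix.add_apply, ha i j h, hb i j h, add_zero]
  zero_mem' := fun i j _ => rfl
  smul_mem' := fun c A hA i j h => by
    simp only [Matrix.smul_apply, hA i j h, smul_zero]

/-- The `i`-th layer `V_i` of the grading of `𝔫_ℂ`. -/
noncomputable def superdiagC (n i : ℕ) : Submodule ℝ (Matrix (Fin n) (Fin n) ℂ) where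
  carrier := {A | ∀ a b : Fin n, (b : ℕ) ≠ (a : ℕ) + i → A a b = 0}
  add_mem' := fun ha hb a b h => by
    simp only [Matrix.add_apply, ha a b h, hb a b h, add_zero]
  zero_mem' := fun a b _ => rfl
  smul_mem' := fun c A hA a b h => by
    simp only [Matrix.smul_apply, hA a b h, smul_zero]

/-- The graded automorphism `τ` of `𝔫_ℂ`,
`(τ A)_{i,j} = -conj (A_{n-j+1, n-i+1})` (1-indexed; `Fin.rev` here). -/
def tauC (n : ℕ) (A : Matrix (Fin n) (Fin n) ℂ) : Matrix (Fin n) (Fin n) ℂ :=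
  Matrix.of fun i j => - star (A j.rev i.rev)

/-- Entrywise complex conjugation of a matrix. -/
def entrywiseConj (n : ℕ) (A : Matrix (Fin n) (Fin n) ℂ) : Matrix (Fin n) (Fin n) ℂ :=
  Matrix.of fun a b => star (A a b)

open Matrix in
theorem single_mem_strictlyUpperC {n : ℕ} {p q : Fin n} (h : p < q) (a : ℂ) :
    single p q a ∈ strictlyUpperC n := by
  intro i j hij
  rw [single_apply_of_ne]
  rintro ⟨rfl, rfl⟩
  exact absurd h (not_lt.mpr hij)

open Matrix in
theorem single_mem_superdiagC {n : ℕ} {p q : Fin n} {k : ℕ} (h : (q : ℕ) = p + k) (a : ℂ) :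
    single p q a ∈ superdiagC n k := by
  intro i j hij
  rw [single_apply_of_ne]
  rintro ⟨rfl, rfl⟩
  exact hij h

theorem superdiagC_le_strictlyUpperC {n k : ℕ} (hk : 1 ≤ k) :
    superdiagC n k ≤ strictlyUpperC n := by
  intro A hA i j hij
  have : (j : ℕ) ≤ i := hij
  exact hA i j (by omega)

theorem strictlyUpperC_eq_iSup (n : ℕ) :
    strictlyUpperC n = ⨆ (k : ℕ) (_ : 1 ≤ k), superdiagC n k := by
  apply le_antisymm
  · intro A hA
    rw [Matrix.matrix_eq_sum_single A]
    refine Submodule.sum_mem _ fun i _ => Submodule.sum_mem _ fun j _ => ?_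
    rcases le_or_gt j i with h | h
    · rw [hA i j h, Matrix.single_zero]
      exact Submodule.zero_mem _
    · have h' : (i : ℕ) < j := h
      exact Submodule.mem_iSup_of_mem ((j : ℕ) - i) (Submodule.mem_iSup_of_mem (by omega)
        (single_mem_superdiagC (by omega) _))
  · exact iSup₂_le fun k hk => superdiagC_le_strictlyUpperC hk

theorem mul_mem_strictlyUpperC {n : ℕ} {A B : Matrix (Fin n) (Fin n) ℂ}
    (hA : A ∈ strictlyUpperC n) (hB : B ∈ strictlyUpperC n) : A * B ∈ strictlyUpperC n := by
  intro i j hij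
  rw [Matrix.mul_apply]
  refine Finset.sum_eq_zero fun k _ => ?_
  rcases le_or_gt k i with h | h
  · rw [hA i k h, zero_mul]
  · rw [hB k j (hij.trans h.le), mul_zero]

theorem commutator_mem_strictlyUpperC {n : ℕ} {A B : Matrix (Fin n) (Fin n) ℂ}
    (hA : A ∈ strictlyUpperC n) (hB : B ∈ strictlyUpperC n) :
    A * B - B * A ∈ strictlyUpperC n :=
  Submodule.sub_mem _ (mul_mem_strictlyUpperC hA hB) (mul_mem_strictlyUpperC hB hA)

theorem map_strictlyUpperC {n : ℕ} {φ : Matrix (Fin n) (Fin n) ℂ →ₗ[ℝ] Matrix (Fin n) (Fin n) ℂ}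
    (hgraded : ∀ i : ℕ, 1 ≤ i → Submodule.map φ (superdiagC n i) = superdiagC n i) :
    Submodule.map φ (strictlyUpperC n) = strictlyUpperC n := by
  rw [strictlyUpperC_eq_iSup]
  simp only [Submodule.map_iSup]
  exact iSup_congr fun k => iSup_congr fun hk => hgraded k hk

/-- `A` is an absolute zero divisor of `𝔫_ℂ`: `(ad A)² = 0`. -/
def AdSqZero {n : ℕ} (A : Matrix (Fin n) (Fin n) ℂ) : Prop :=
  ∀ B ∈ strictlyUpperC n, A * (A * B - B * A) - (A * B - B * A) * A = 0

theorem adSqZero_map_iff {n : ℕ}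
    {φ : Matrix (Fin n) (Fin n) ℂ →ₗ[ℝ] Matrix (Fin n) (Fin n) ℂ}
    (hmap : Submodule.map φ (strictlyUpperC n) = strictlyUpperC n)
    (hbracket : ∀ A ∈ strictlyUpperC n, ∀ B ∈ strictlyUpperC n,
      φ (A * B - B * A) = φ A * φ B - φ B * φ A)
    (hinj : ∀ A ∈ strictlyUpperC n, φ A = 0 → A = 0)
    {A : Matrix (Fin n) (Fin n) ℂ} (hA : A ∈ strictlyUpperC n) :
    AdSqZero (φ A) ↔ AdSqZero A := by
  have key : ∀ B ∈ strictlyUpperC n, φ (A * (A * B - B * A) - (A * B - B * A) * A) =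
      φ A * (φ A * φ B - φ B * φ A) - (φ A * φ B - φ B * φ A) * φ A := fun B hB => by
    rw [hbracket A hA _ (commutator_mem_strictlyUpperC hA hB), hbracket A hA B hB]
  constructor
  · intro h B hB
    refine hinj _ (commutator_mem_strictlyUpperC hA (commutator_mem_strictlyUpperC hA hB)) ?_
    rw [key B hB]
    exact h _ (hmap ▸ Submodule.mem_map_of_mem hB)
  · intro h B hB
    rw [← hmap] at hB
    obtain ⟨B, hB, rfl⟩ := hB
    rw [← key B hB, h B hB, map_zero]

/-- The elements of the `i`-th simple root space of `𝔫_ℂ`. -/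
def simpleRoot {m : ℕ} (i : Fin m) (a : ℂ) : Matrix (Fin (m + 1)) (Fin (m + 1)) ℂ :=
  Matrix.single i.castSucc i.succ a

theorem simpleRoot_mem {m : ℕ} (i : Fin m) (a : ℂ) :
    simpleRoot i a ∈ strictlyUpperC (m + 1) :=
  single_mem_strictlyUpperC Fin.castSucc_lt_succ a

theorem simpleRoot_mem_superdiagC {m : ℕ} (i : Fin m) (a : ℂ) :
    simpleRoot i a ∈ superdiagC (m + 1) 1 :=
  single_mem_superdiagC (by simp) a

theorem simpleRoot_add {m : ℕ} (i : Fin m) (a b : ℂ) :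
    simpleRoot i (a + b) = simpleRoot i a + simpleRoot i b :=
  Matrix.single_add _ _ _ _

theorem simpleRoot_sub {m : ℕ} (i : Fin m) (a b : ℂ) :
    simpleRoot i (a - b) = simpleRoot i a - simpleRoot i b :=
  eq_sub_of_add_eq (by rw [← simpleRoot_add, sub_add_cancel])

theorem simpleRoot_apply_self {m : ℕ} (i : Fin m) (a : ℂ) :
    simpleRoot i a i.castSucc i.succ = a :=
  Matrix.single_apply_same _ _ _

theorem simpleRoot_apply_of_ne {m : ℕ} {i j : Fin m} (h : i ≠ j) (a : ℂ) :
    simpleRoot i a j.castSucc j.succ = 0 :=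
  Matrix.single_apply_of_ne _ _ _ _ _ fun h' => h (Fin.castSucc_injective _ h'.1)

theorem simpleRoot_eq_zero_iff {m : ℕ} {i : Fin m} {a : ℂ} : simpleRoot i a = 0 ↔ a = 0 := by
  constructor
  · intro h
    rw [← simpleRoot_apply_self i a, h, Matrix.zero_apply]
  · rintro rfl
    exact Matrix.single_zero _ _

theorem eq_simpleRoot {m : ℕ} {A : Matrix (Fin (m + 1)) (Fin (m + 1)) ℂ}
    (hA : A ∈ superdiagC (m + 1) 1) (i : Fin m)
    (h : ∀ j, j ≠ i → A j.castSucc j.succ = 0) :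
    A = simpleRoot i (A i.castSucc i.succ) := by
  ext p q
  by_cases hpq : (q : ℕ) = p + 1
  · obtain ⟨j, rfl⟩ : ∃ j : Fin m, j.castSucc = p := ⟨⟨p, by omega⟩, rfl⟩
    obtain rfl : j.succ = q := Fin.ext (by simpa using hpq.symm)
    by_cases hj : j = i
    · subst hj
      rw [simpleRoot_apply_self]
    · rw [h j hj, simpleRoot_apply_of_ne (Ne.symm hj)]
  · rw [hA p q hpq, simpleRoot_mem_superdiagC i _ p q hpq]

theorem adSqZero_simpleRoot {m : ℕ} (i : Fin m) (a : ℂ) : AdSqZero (simpleRoot i a) := by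
  intro B hB
  have hsq : simpleRoot i a * simpleRoot i a = 0 :=
    Matrix.single_mul_single_of_ne _ _ _ _ (Fin.castSucc_lt_succ).ne' _
  have hmid : simpleRoot i a * B * simpleRoot i a = 0 := by
    rw [simpleRoot, Matrix.single_mul_mul_single, hB _ _ Fin.castSucc_lt_succ.le]
    simp
  calc _ = simpleRoot i a * simpleRoot i a * B
        - 2 • (simpleRoot i a * B * simpleRoot i a)
        + B * (simpleRoot i a * simpleRoot i a) := by noncomm_ring
    _ = 0 := by simp [hsq, hmid]

theorem mul_apply_of_mem_superdiagC_one {n : ℕ} {A B : Matrix (Fin n) (Fin n) ℂ}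
    (hA : A ∈ superdiagC n 1) {p r : Fin n} (hr : (r : ℕ) = p + 1) (q : Fin n) :
    (A * B) p q = A p r * B r q := by
  rw [Matrix.mul_apply]
  refine Finset.sum_eq_single r (fun k _ hk => ?_) (by simp)
  rw [hA p k fun h => hk (Fin.ext (h.trans hr.symm)), zero_mul]

theorem AdSqZero.mul_eq_zero_of_lt {m : ℕ} (hm : 3 ≤ m)
    {A : Matrix (Fin (m + 1)) (Fin (m + 1)) ℂ} (hA : A ∈ superdiagC (m + 1) 1)
    (h : AdSqZero A) {i j : Fin m} (hij : i < j) :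
    A i.castSucc i.succ * A j.castSucc j.succ = 0 := by
  have key : ∀ u v : Fin (m + 1), u < v → ∀ p q,
      (A * A * Matrix.single u v (1 : ℂ) : Matrix _ _ ℂ) p q
        - 2 * (A * Matrix.single u v (1 : ℂ) * A : Matrix _ _ ℂ) p q
        + (Matrix.single u v (1 : ℂ) * (A * A) : Matrix _ _ ℂ) p q = 0 := by
    intro u v huv p q
    have e := congrFun (congrFun (h _ (single_mem_strictlyUpperC huv 1)) p) q
    have e' : A * (A * Matrix.single u v 1 - Matrix.single u v 1 * A)
        - (A * Matrix.single u v 1 - Matrix.single u v 1 * A) * A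
        = A * A * Matrix.single u v 1 - 2 • (A * Matrix.single u v 1 * A)
          + Matrix.single u v 1 * (A * A) := by noncomm_ring
    rw [e'] at e
    simpa [two_mul, two_smul] using e
  have hij' : (i : ℕ) < j := hij
  by_cases hadj : (j : ℕ) = i + 1
  · have hsucc : i.succ = j.castSucc := Fin.ext (by simp [hadj])
    by_cases hjm : (j : ℕ) + 1 < m
    · have e := key j.succ ⟨j + 2, by omega⟩ (Fin.lt_def.mpr (by simp)) i.castSucc ⟨j + 2, by omega⟩
      rw [Matrix.mul_single_apply_same, Matrix.single_mul_apply_of_ne,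
        mul_apply_of_mem_superdiagC_one (r := i.succ) hA (by simp),
        Matrix.mul_assoc, mul_apply_of_mem_superdiagC_one (r := i.succ) hA (by simp),
        Matrix.single_mul_apply_of_ne, hsucc] at e
      · simpa [hsucc] using e
      · simp [Fin.ext_iff]; omega
      · simp [Fin.ext_iff]; omega
    · have e := key ⟨i - 1, by omega⟩ i.castSucc (Fin.lt_def.mpr (by simp; omega))
        ⟨i - 1, by omega⟩ j.succ
      rw [Matrix.single_mul_apply_same, Matrix.mul_single_apply_of_ne,
        mul_apply_of_mem_superdiagC_one (r := i.succ) hA (by simp),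
        Matrix.mul_assoc, mul_apply_of_mem_superdiagC_one (r := i.castSucc) hA
          (by simp; omega),
        Matrix.single_mul_apply_of_ne, hsucc] at e
      · simpa [hsucc] using e
      · simp [Fin.ext_iff]; omega
      · simp [Fin.ext_iff]; omega
  · have e := key i.succ j.castSucc (Fin.lt_def.mpr (by simp; omega)) i.castSucc j.succ
    rw [Matrix.mul_single_apply_of_ne, Matrix.single_mul_apply_of_ne, Matrix.mul_assoc,
      mul_apply_of_mem_superdiagC_one (r := i.succ) hA (by simp),
      Matrix.single_mul_apply_same] at e
    · simpa using e
    · simp [Fin.ext_iff]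
    · simp [Fin.ext_iff]

theorem AdSqZero.eq_simpleRoot {m : ℕ} (hm : 3 ≤ m)
    {A : Matrix (Fin (m + 1)) (Fin (m + 1)) ℂ} (hA : A ∈ superdiagC (m + 1) 1)
    (h : AdSqZero A) {i : Fin m} (hi : A i.castSucc i.succ ≠ 0) :
    A = simpleRoot i (A i.castSucc i.succ) := by
  refine _root_.eq_simpleRoot hA i fun j hj => ?_
  rcases lt_or_gt_of_ne hj with hlt | hlt
  · exact (mul_eq_zero.mp (h.mul_eq_zero_of_lt hm hA hlt)).resolve_right hi
  · exact (mul_eq_zero.mp (h.mul_eq_zero_of_lt hm hA hlt)).resolve_left hi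

theorem exists_apply_ne_zero_of_mem_superdiagC {m : ℕ}
    {A : Matrix (Fin (m + 1)) (Fin (m + 1)) ℂ} (hA : A ∈ superdiagC (m + 1) 1) (h : A ≠ 0) :
    ∃ i : Fin m, A i.castSucc i.succ ≠ 0 := by
  by_contra! h0
  rcases Nat.eq_zero_or_pos m with rfl | hm
  · refine h (Matrix.ext fun p q => hA p q ?_)
    omega
  · refine h ?_
    rw [_root_.eq_simpleRoot hA ⟨0, hm⟩ fun j _ => h0 j, h0, simpleRoot_eq_zero_iff]

/-- A real-linear map of `𝔫_ℂ` that preserves the first layer and absolute zero divisors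
permutes the simple root spaces. -/
theorem exists_injective_map_simpleRoot {m : ℕ} (hm : 3 ≤ m)
    {φ : Matrix (Fin (m + 1)) (Fin (m + 1)) ℂ →ₗ[ℝ] Matrix (Fin (m + 1)) (Fin (m + 1)) ℂ}
    (hφ : ∀ A ∈ superdiagC (m + 1) 1, φ A ∈ superdiagC (m + 1) 1)
    (had : ∀ A ∈ superdiagC (m + 1) 1, AdSqZero (φ A) ↔ AdSqZero A)
    (hinj : ∀ A ∈ superdiagC (m + 1) 1, φ A = 0 → A = 0) :
    ∃ σ : Fin m → Fin m, Function.Injective σ ∧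
      ∀ i a, ∃ b, φ (simpleRoot i a) = simpleRoot (σ i) b := by
  have hne : ∀ i : Fin m, ∃ j : Fin m, φ (simpleRoot i 1) j.castSucc j.succ ≠ 0 := fun i =>
    exists_apply_ne_zero_of_mem_superdiagC (hφ _ (simpleRoot_mem_superdiagC i 1)) fun h =>
      one_ne_zero (simpleRoot_eq_zero_iff.mp (hinj _ (simpleRoot_mem_superdiagC i 1) h))
  choose σ hσ using hne
  have hsingle : ∀ i a, AdSqZero (φ (simpleRoot i a)) := fun i a =>
    (had _ (simpleRoot_mem_superdiagC i a)).mpr (adSqZero_simpleRoot i a)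
  have hφmem : ∀ (i : Fin m) a, φ (simpleRoot i a) ∈ superdiagC (m + 1) 1 := fun i a =>
    hφ _ (simpleRoot_mem_superdiagC i a)
  have hone : ∀ i, φ (simpleRoot i 1) = simpleRoot (σ i) _ := fun i =>
    (hsingle i 1).eq_simpleRoot hm (hφmem i 1) (hσ i)
  refine ⟨σ, fun i j hij => ?_, fun i a => ?_⟩
  · by_contra hne
    have hmem := Submodule.add_mem _ (simpleRoot_mem_superdiagC i 1)
      (simpleRoot_mem_superdiagC j 1)
    have hsum : AdSqZero (simpleRoot i 1 + simpleRoot j 1) := by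
      rw [← had _ hmem, map_add, hone i, hone j, hij, ← simpleRoot_add]
      exact adSqZero_simpleRoot _ _
    have hi : (simpleRoot i 1 + simpleRoot j 1) i.castSucc i.succ ≠ 0 := by
      rw [Matrix.add_apply, simpleRoot_apply_self, simpleRoot_apply_of_ne (Ne.symm hne)]
      simp
    have e := congrFun (congrFun (hsum.eq_simpleRoot hm hmem hi) j.castSucc) j.succ
    rw [simpleRoot_apply_of_ne hne, Matrix.add_apply, simpleRoot_apply_self,
      simpleRoot_apply_of_ne hne] at e
    simp at e
  · by_cases ha : φ (simpleRoot i a) (σ i).castSucc (σ i).succ = 0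
    · have h1 : φ (simpleRoot i (a + 1)) (σ i).castSucc (σ i).succ ≠ 0 := by
        rw [simpleRoot_add, map_add, Matrix.add_apply, ha, zero_add]
        exact hσ i
      have e := (hsingle i (a + 1)).eq_simpleRoot hm (hφmem i _) h1
      generalize φ (simpleRoot i (a + 1)) (σ i).castSucc (σ i).succ = b at e
      rw [simpleRoot_add, map_add, hone i] at e
      exact ⟨_, (eq_sub_of_add_eq e).trans (simpleRoot_sub _ _ _).symm⟩
    · exact ⟨_, (hsingle i a).eq_simpleRoot hm (hφmem i a) ha⟩

/-- An injective self-map of a path that preserves adjacency is the identity or the reversal. -/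
theorem Fin.eq_id_or_rev_of_adjacent {m : ℕ} {σ : Fin m → Fin m} (hσ : Function.Injective σ)
    (hadj : ∀ i j : Fin m, (j : ℕ) = i + 1 →
      (σ j : ℕ) = σ i + 1 ∨ (σ i : ℕ) = σ j + 1) :
    (∀ i, σ i = i) ∨ ∀ i, σ i = i.rev := by
  rcases Nat.lt_or_ge m 2 with hm | hm
  · left
    intro i
    apply Fin.ext
    omega
  have hne : ∀ i j : Fin m, (j : ℕ) = i + 2 → (σ i : ℕ) ≠ σ j := fun i j h h' => by
    have := congrArg Fin.val (hσ (Fin.ext h'))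
    omega
  have hlast := (σ ⟨m - 1, by omega⟩).isLt
  rcases hadj ⟨0, by omega⟩ ⟨1, by omega⟩ rfl with h01 | h01
  · have step : ∀ k, ∀ hk : k + 1 < m, (σ ⟨k + 1, hk⟩ : ℕ) = σ ⟨k, by omega⟩ + 1 := by
      intro k
      induction k with
      | zero => exact fun _ => h01
      | succ k ih =>
        intro hk
        have := ih (by omega)
        have := hne ⟨k, by omega⟩ ⟨k + 1 + 1, hk⟩ rfl
        have := hadj ⟨k + 1, by omega⟩ ⟨k + 1 + 1, hk⟩ rfl
        omega
    have all : ∀ k, ∀ hk : k < m, (σ ⟨k, hk⟩ : ℕ) = σ ⟨0, by omega⟩ + k := by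
      intro k
      induction k with
      | zero => exact fun _ => rfl
      | succ k ih =>
        intro hk
        rw [step k hk, ih (by omega)]
        omega
    have := all (m - 1) (by omega)
    refine Or.inl fun i => Fin.ext ?_
    have := all i i.isLt
    rw [Fin.eta] at this
    omega
  · have step : ∀ k, ∀ hk : k + 1 < m, (σ ⟨k, by omega⟩ : ℕ) = σ ⟨k + 1, hk⟩ + 1 := by
      intro k
      induction k with
      | zero => exact fun _ => h01
      | succ k ih =>
        intro hk
        have := ih (by omega)
        have := hne ⟨k, by omega⟩ ⟨k + 1 + 1, hk⟩ rfl
        have := hadj ⟨k + 1, by omega⟩ ⟨k + 1 + 1, hk⟩ rfl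
        omega
    have all : ∀ k, ∀ hk : k < m, (σ ⟨0, by omega⟩ : ℕ) = σ ⟨k, hk⟩ + k := by
      intro k
      induction k with
      | zero => exact fun _ => rfl
      | succ k ih =>
        intro hk
        rw [ih (by omega), step k hk]
        omega
    have := all (m - 1) (by omega)
    have := (σ ⟨0, by omega⟩).isLt
    refine Or.inr fun i => Fin.ext ?_
    have := all i i.isLt
    rw [Fin.eta] at this
    rw [Fin.val_rev]
    omega

theorem adjacent_of_commutator_simpleRoot_ne_zero {m : ℕ} {i j : Fin m} {a b : ℂ}
    (h : simpleRoot i a * simpleRoot j b - simpleRoot j b * simpleRoot i a ≠ 0) :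
    (j : ℕ) = i + 1 ∨ (i : ℕ) = j + 1 := by
  by_contra! hne
  refine h ?_
  rw [simpleRoot, simpleRoot, Matrix.single_mul_single_of_ne, Matrix.single_mul_single_of_ne,
    sub_zero]
  · exact fun e => hne.2 (by simpa using (congrArg Fin.val e).symm)
  · exact fun e => hne.1 (by simpa using (congrArg Fin.val e).symm)

theorem commutator_single {n : ℕ} {p q r : Fin n} (h : p ≠ r) (a b : ℂ) :
    Matrix.single p q a * Matrix.single q r b - Matrix.single q r b * Matrix.single p q a
      = Matrix.single p r (a * b) := by
  rw [Matrix.single_mul_single_same, Matrix.single_mul_single_of_ne _ _ _ _ h.symm, sub_zero]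

theorem commutator_simpleRoot {m : ℕ} {i j : Fin m} (h : (j : ℕ) = i + 1) (a b : ℂ) :
    simpleRoot i a * simpleRoot j b - simpleRoot j b * simpleRoot i a
      = Matrix.single i.castSucc j.succ (a * b) := by
  have hij : i.succ = j.castSucc := Fin.ext (by simp [h])
  rw [simpleRoot, simpleRoot, hij]
  exact commutator_single (by simp [Fin.ext_iff]; omega) a b

theorem Complex.exists_algHom_of_apply_mul_apply {f f' : ℂ →ₗ[ℝ] ℂ} (hf : f 1 ≠ 0)
    (hf' : f' 1 ≠ 0) (h : ∀ a b, f a * f' b = f (a * b) * f' 1) :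
    ∃ g : ℂ →ₐ[ℝ] ℂ, (∀ a, f a = f 1 * g a) ∧ ∀ a, f' a = f' 1 * g a := by
  have h' : ∀ a, f' a = f' 1 * ((f 1)⁻¹ * f a) := fun a => by
    have := h 1 a
    rw [one_mul] at this
    field_simp
    linear_combination this
  refine ⟨AlgHom.ofLinearMap ((LinearMap.mulLeft ℝ (f 1)⁻¹).comp f) ?_ ?_, ?_, ?_⟩
  · simp [hf]
  · intro a b
    have e := h a b
    rw [h' b] at e
    have e' := mul_left_cancel₀ hf' (a := f' 1) (b := f a * ((f 1)⁻¹ * f b)) (c := f (a * b))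
      (by linear_combination e)
    simp only [LinearMap.comp_apply, LinearMap.mulLeft_apply]
    rw [← e']
    ring
  · intro a
    simp [hf]
  · intro a
    simpa using h' a

theorem exists_algHom_map_simpleRoot {m : ℕ} (hm : 2 ≤ m)
    {φ : Matrix (Fin (m + 1)) (Fin (m + 1)) ℂ →ₗ[ℝ] Matrix (Fin (m + 1)) (Fin (m + 1)) ℂ}
    (hbracket : ∀ A ∈ strictlyUpperC (m + 1), ∀ B ∈ strictlyUpperC (m + 1),
      φ (A * B - B * A) = φ A * φ B - φ B * φ A)
    (hne : ∀ i : Fin m, φ (simpleRoot i 1) ≠ 0)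
    (hroot : ∀ (i : Fin m) a, ∃ b, φ (simpleRoot i a) = simpleRoot i b) :
    ∃ (g : ℂ →ₐ[ℝ] ℂ) (c : Fin m → ℂ), (∀ i, c i ≠ 0) ∧
      ∀ i a, φ (simpleRoot i a) = simpleRoot i (c i * g a) := by
  choose f hf using hroot
  have hf_eq : ∀ i a, f i a = φ (simpleRoot i a) i.castSucc i.succ := fun i a => by
    rw [hf, simpleRoot_apply_self]
  let F : Fin m → ℂ →ₗ[ℝ] ℂ := fun i =>
    { toFun := f i
      map_add' := fun a b => by
        simp only [hf_eq, simpleRoot_add, map_add, Matrix.add_apply]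
      map_smul' := fun r a => by
        have : simpleRoot i (r • a) = r • simpleRoot i a := (Matrix.smul_single _ _ _ _).symm
        simp only [hf_eq, this, map_smul, Matrix.smul_apply, RingHom.id_apply] }
  have hone : ∀ i, F i 1 ≠ 0 := fun i h => hne i (by
    rw [hf i 1, simpleRoot_eq_zero_iff]
    exact h)
  have hbr : ∀ i j : Fin m, (j : ℕ) = i + 1 → ∀ a b,
      φ (Matrix.single i.castSucc j.succ (a * b)) =
        Matrix.single i.castSucc j.succ (F i a * F j b) := fun i j hij a b => by
    rw [← commutator_simpleRoot hij, hbracket _ (simpleRoot_mem i a) _ (simpleRoot_mem j b), hf, hf,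
      commutator_simpleRoot hij]
    rfl
  have hmul : ∀ i j : Fin m, (j : ℕ) = i + 1 → ∀ a b,
      F i a * F j b = F i (a * b) * F j 1 := fun i j hij a b => by
    have := (hbr i j hij a b).symm.trans ((congrArg _ (by rw [mul_one])).trans
      (hbr i j hij (a * b) 1))
    simpa using congrFun (congrFun this i.castSucc) j.succ
  obtain ⟨g, hg, -⟩ := Complex.exists_algHom_of_apply_mul_apply (hone ⟨0, by omega⟩)
    (hone ⟨1, by omega⟩) (hmul ⟨0, by omega⟩ ⟨1, by omega⟩ rfl)
  have hall : ∀ k, ∀ hk : k < m, ∀ a, F ⟨k, hk⟩ a = F ⟨k, hk⟩ 1 * g a := by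
    intro k
    induction k with
    | zero => exact fun _ => hg
    | succ k ih =>
      intro hk a
      have e := hmul ⟨k, by omega⟩ ⟨k + 1, hk⟩ rfl 1 a
      rw [one_mul, ih (by omega) a] at e
      refine mul_left_cancel₀ (hone ⟨k, by omega⟩) ?_
      linear_combination e
  refine ⟨g, fun i => F i 1, hone, fun i a => ?_⟩
  rw [hf, ← hall i i.isLt a]
  rfl

theorem map_single_of_map_simpleRoot {m : ℕ}
    {φ : Matrix (Fin (m + 1)) (Fin (m + 1)) ℂ →ₗ[ℝ] Matrix (Fin (m + 1)) (Fin (m + 1)) ℂ}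
    (hbracket : ∀ A ∈ strictlyUpperC (m + 1), ∀ B ∈ strictlyUpperC (m + 1),
      φ (A * B - B * A) = φ A * φ B - φ B * φ A)
    {g : ℂ →ₐ[ℝ] ℂ} {μ : Fin (m + 1) → ℂ} (hμ : ∀ p, μ p ≠ 0)
    (hroot : ∀ (i : Fin m) a,
      φ (simpleRoot i a) = simpleRoot i (μ i.castSucc * g a * (μ i.succ)⁻¹))
    {p q : Fin (m + 1)} (hpq : p < q) (a : ℂ) :
    φ (Matrix.single p q a) = Matrix.single p q (μ p * g a * (μ q)⁻¹) := by
  induction q using Fin.induction generalizing a with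
  | zero => exact absurd hpq (Fin.not_lt_zero p)
  | succ j ih =>
    rcases (Fin.le_castSucc_iff.mpr hpq).eq_or_lt with rfl | hlt
    · exact hroot j a
    · have hbr := hbracket _ (single_mem_strictlyUpperC hlt a) _ (simpleRoot_mem j 1)
      rw [hroot, ih hlt a, simpleRoot, simpleRoot, commutator_single hpq.ne,
        commutator_single hpq.ne, mul_one, map_one] at hbr
      rw [hbr]
      congr 1
      field_simp [hμ]

theorem map_eq_of_map_simpleRoot {m : ℕ} (hm : 2 ≤ m)
    {φ : Matrix (Fin (m + 1)) (Fin (m + 1)) ℂ →ₗ[ℝ] Matrix (Fin (m + 1)) (Fin (m + 1)) ℂ}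
    (hbracket : ∀ A ∈ strictlyUpperC (m + 1), ∀ B ∈ strictlyUpperC (m + 1),
      φ (A * B - B * A) = φ A * φ B - φ B * φ A)
    (hne : ∀ i : Fin m, φ (simpleRoot i 1) ≠ 0)
    (hroot : ∀ (i : Fin m) a, ∃ b, φ (simpleRoot i a) = simpleRoot i b) :
    ∃ (ε : Bool) (lam : Fin (m + 1) → ℂ), (∀ i, lam i ≠ 0) ∧
      ∀ A ∈ strictlyUpperC (m + 1),
        φ A = (cond ε (entrywiseConj (m + 1)) id)
          (Matrix.diagonal lam * A * Matrix.diagonal fun i => (lam i)⁻¹) := by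
  obtain ⟨g, c, hc, hφ⟩ := exists_algHom_map_simpleRoot hm hbracket hne hroot
  let μ : Fin (m + 1) → ℂ := fun p => Fin.induction (motive := fun _ => ℂ) 1 (fun i r => r / c i) p
  have hμs : ∀ i : Fin m, μ i.succ = μ i.castSucc / c i := fun i => Fin.induction_succ _ _ i
  have hμ : ∀ p, μ p ≠ 0 := fun p => by
    induction p using Fin.induction with
    | zero => exact one_ne_zero
    | succ i ih =>
      rw [hμs]
      exact div_ne_zero ih (hc i)
  have hφ' : ∀ (i : Fin m) a,
      φ (simpleRoot i a) = simpleRoot i (μ i.castSucc * g a * (μ i.succ)⁻¹) := fun i a => by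
    rw [hφ, hμs]
    congr 1
    have := hμ i.castSucc
    have := hc i
    field_simp
  have hentry : ∀ A ∈ strictlyUpperC (m + 1), ∀ p q,
      φ A p q = μ p * g (A p q) * (μ q)⁻¹ := fun A hA p q => by
    have hsingle : ∀ i j, φ (Matrix.single i j (A i j)) =
        Matrix.single i j (μ i * g (A i j) * (μ j)⁻¹) := fun i j => by
      rcases le_or_gt j i with h | h
      · simp [hA i j h]
      · exact map_single_of_map_simpleRoot hbracket hμ hφ' h _
    conv_lhs => rw [Matrix.matrix_eq_sum_single A]
    simp only [map_sum, hsingle]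
    exact (congrFun (congrFun (Matrix.matrix_eq_sum_single
      (Matrix.of fun i j => μ i * g (A i j) * (μ j)⁻¹)) p) q).symm
  rcases Complex.real_algHom_eq_id_or_conj g with rfl | rfl
  · refine ⟨false, μ, hμ, fun A hA => ?_⟩
    ext p q
    simp [hentry A hA]
  · refine ⟨true, fun p => star (μ p), fun p => star_ne_zero.mpr (hμ p), fun A hA => ?_⟩
    ext p q
    simp [hentry A hA, entrywiseConj]

theorem tauC_tauC {n : ℕ} (A : Matrix (Fin n) (Fin n) ℂ) : tauC n (tauC n A) = A := by
  ext i j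
  simp [tauC]

theorem tauC_sub {n : ℕ} (A B : Matrix (Fin n) (Fin n) ℂ) :
    tauC n (A - B) = tauC n A - tauC n B := by
  ext i j
  simp [tauC]
  ring

theorem tauC_mul {n : ℕ} (A B : Matrix (Fin n) (Fin n) ℂ) :
    tauC n (A * B) = -(tauC n B * tauC n A) := by
  ext i j
  simp only [tauC, Matrix.of_apply, Matrix.neg_apply, Matrix.mul_apply, star_sum, star_mul,
    neg_mul_neg]
  rw [← Equiv.sum_comp Fin.revPerm]
  rfl

theorem tauC_commutator {n : ℕ} (A B : Matrix (Fin n) (Fin n) ℂ) :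
    tauC n (A * B - B * A) = tauC n A * tauC n B - tauC n B * tauC n A := by
  rw [tauC_sub, tauC_mul, tauC_mul]
  abel

theorem tauC_simpleRoot {m : ℕ} (i : Fin m) (a : ℂ) :
    tauC (m + 1) (simpleRoot i a) = simpleRoot i.rev (-star a) := by
  ext p q
  simp only [tauC, simpleRoot, Matrix.of_apply, Matrix.single_apply]
  have h : i.castSucc = q.rev ∧ i.succ = p.rev ↔ i.rev.castSucc = p ∧ i.rev.succ = q := by
    rw [← Fin.rev_succ, ← Fin.rev_castSucc, Fin.rev_eq_iff, Fin.rev_eq_iff, and_comm]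
  by_cases h' : i.rev.castSucc = p ∧ i.rev.succ = q
  · rw [if_pos h', if_pos (h.mpr h')]
  · rw [if_neg h', if_neg (mt h.mp h'), star_zero, neg_zero]

/-- `tauC` as a real-linear map. -/
def tauCLinear (n : ℕ) : Matrix (Fin n) (Fin n) ℂ →ₗ[ℝ] Matrix (Fin n) (Fin n) ℂ where
  toFun := tauC n
  map_add' A B := by
    ext i j
    simp [tauC]
    ring
  map_smul' r A := by
    ext i j
    simp [tauC]

/-- Every graded automorphism of `𝔫_ℂ` (for `n ≥ 4`) is of the form
`τ^{ε₁} ∘ C^{ε₂} ∘ Ad_g` with `C` entrywise complex conjugation,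
`g` an invertible diagonal complex matrix and `ε₁, ε₂ ∈ {0,1}`. -/
theorem graded_automorphism_classification_complex
    (n : ℕ) (hn : 4 ≤ n)
    (φ : Matrix (Fin n) (Fin n) ℂ →ₗ[ℝ] Matrix (Fin n) (Fin n) ℂ)
    (hgraded : ∀ i : ℕ, 1 ≤ i → Submodule.map φ (superdiagC n i) = superdiagC n i)
    (hbracket : ∀ A ∈ strictlyUpperC n, ∀ B ∈ strictlyUpperC n,
      φ (A * B - B * A) = φ A * φ B - φ B * φ A)
    (hinj : ∀ A ∈ strictlyUpperC n, φ A = 0 → A = 0) :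
    ∃ (ε₁ ε₂ : Bool) (lam : Fin n → ℂ), (∀ i, lam i ≠ 0) ∧
      ∀ A ∈ strictlyUpperC n,
        φ A = (cond ε₁ (tauC n) id) ((cond ε₂ (entrywiseConj n) id)
          (Matrix.diagonal lam * A * Matrix.diagonal fun i => (lam i)⁻¹)) := by
  obtain ⟨m, rfl⟩ : ∃ m, n = m + 1 := ⟨n - 1, by omega⟩
  have hle : superdiagC (m + 1) 1 ≤ strictlyUpperC (m + 1) := superdiagC_le_strictlyUpperC le_rfl
  obtain ⟨σ, hσ, hroot⟩ := exists_injective_map_simpleRoot (φ := φ) (by omega)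
    (fun A hA => hgraded 1 le_rfl ▸ Submodule.mem_map_of_mem hA)
    (fun A hA => adSqZero_map_iff (map_strictlyUpperC hgraded) hbracket hinj (hle hA))
    (fun A hA => hinj A (hle hA))
  have hne : ∀ i : Fin m, φ (simpleRoot i 1) ≠ 0 := fun i h =>
    one_ne_zero (simpleRoot_eq_zero_iff.mp (hinj _ (simpleRoot_mem i 1) h))
  have hadj : ∀ i j : Fin m, (j : ℕ) = i + 1 →
      (σ j : ℕ) = σ i + 1 ∨ (σ i : ℕ) = σ j + 1 := fun i j hij => by
    obtain ⟨a, ha⟩ := hroot i 1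
    obtain ⟨b, hb⟩ := hroot j 1
    apply adjacent_of_commutator_simpleRoot_ne_zero (a := a) (b := b)
    rw [← ha, ← hb, ← hbracket _ (simpleRoot_mem i 1) _ (simpleRoot_mem j 1)]
    intro h
    have h0 := hinj _ (commutator_mem_strictlyUpperC (simpleRoot_mem i 1) (simpleRoot_mem j 1)) h
    rw [commutator_simpleRoot hij] at h0
    have := congrFun (congrFun h0 i.castSucc) j.succ
    simp at this
  rcases Fin.eq_id_or_rev_of_adjacent hσ hadj with hid | hrev
  · obtain ⟨ε, lam, hlam, h⟩ := map_eq_of_map_simpleRoot (by omega) hbracket hne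
      fun i a => by
        have := hroot i a
        rwa [hid i] at this
    exact ⟨false, ε, lam, hlam, h⟩
  · obtain ⟨ε, lam, hlam, h⟩ := map_eq_of_map_simpleRoot
      (φ := (tauCLinear (m + 1)).comp φ) (by omega)
      (fun A hA B hB => by
        rw [LinearMap.comp_apply, hbracket A hA B hB]
        exact tauC_commutator _ _)
      (fun i h => hne i (by
        rw [← tauC_tauC (φ (simpleRoot i 1))]
        exact (congrArg (tauCLinear (m + 1)) h).trans (map_zero _)))
      (fun i a => by
        obtain ⟨b, hb⟩ := hroot i a
        refine ⟨-star b, ?_⟩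
        rw [LinearMap.comp_apply, hb, hrev i]
        exact (tauC_simpleRoot _ _).trans (by rw [Fin.rev_rev]))
    refine ⟨true, ε, lam, hlam, fun A hA => ?_⟩
    rw [← h A hA]
    exact (tauC_tauC (φ A)).symm
end

section
/- Let U ⊆ ℍ² be a connected open subset and let φ = (φ₁, φ₂) : U → ℍ² be a continuous map such that: (i) for every v ∈ {e₁, e₂, e₁+e₂} and every line L parallel to v, the image φ(L ∩ U) is contained in a line parallel to v; and (ii) for each q ∈ {i, j, k} and every line L parallel to e₁ + q e₂, the image φ(L ∩ U) is contained in some line. Then there exist a, b₁, b₂ ∈ ℍ and a map h : ℍ → ℍ which is either a ring automorphism of ℍ or the zero map, such that φ(x, y) = (a·h(x) + b₁, a·h(y) + b₂) for all (x, y) ∈ U. -/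
open scoped Quaternion

/-- A map which is additive on a ball around `0` and continuous at `0` agrees on that ball with a
continuous linear map. -/
theorem exists_continuousLinearMap_eqOn_ball {E F : Type*}
    [NormedAddCommGroup E] [NormedSpace ℝ E] [NormedAddCommGroup F] [NormedSpace ℝ F]
    {r : ℝ} (hr : 0 < r) {f : E → F} (hf : ContinuousAt f 0)
    (hadd : ∀ u v : E, ‖u‖ < r → ‖v‖ < r → ‖u + v‖ < r → f (u + v) = f u + f v) :
    ∃ A : E →L[ℝ] F, ∀ u, ‖u‖ < r → A u = f u := by
  have hzero : f 0 = 0 := by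
    have := hadd 0 0 (by simpa) (by simpa) (by simpa)
    simpa using this
  have hsmul : ∀ (m : ℕ) (v : E), ‖(m : ℝ) • v‖ < r → f ((m : ℝ) • v) = (m : ℝ) • f v := by
    intro m v
    induction m with
    | zero => simp [hzero]
    | succ m ih =>
      intro h
      have h' : ((m : ℝ) + 1) * ‖v‖ < r := by
        rw [norm_smul, Real.norm_of_nonneg (by positivity)] at h
        exact_mod_cast h
      have hm : 0 ≤ (m : ℝ) * ‖v‖ := by positivity
      have h1 : ‖(m : ℝ) • v‖ < r := by
        rw [norm_smul, Real.norm_of_nonneg (by positivity)]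
        nlinarith [norm_nonneg v]
      have e : ((m + 1 : ℕ) : ℝ) • v = (m : ℝ) • v + v := by
        push_cast
        rw [add_smul, one_smul]
      rw [e] at h ⊢
      rw [hadd _ _ h1 (by nlinarith) h, ih h1]
      push_cast
      rw [add_smul, one_smul]
  have hdiv : ∀ (n m : ℕ) (x : E), 0 < n → 0 < m → ‖x‖ < r * n →
      (n : ℝ) • f ((n : ℝ)⁻¹ • x) = ((n : ℝ) * m) • f (((n : ℝ) * m)⁻¹ • x) := by
    intro n m x hn hm hx
    have hn' : (0 : ℝ) < n := by exact_mod_cast hn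
    have hm' : (0 : ℝ) < m := by exact_mod_cast hm
    have e : (n : ℝ)⁻¹ • x = (m : ℝ) • (((n : ℝ) * m)⁻¹ • x) := by
      rw [smul_smul]
      congr 1
      field_simp
    have hnorm : ‖(n : ℝ)⁻¹ • x‖ < r := by
      rw [norm_smul, Real.norm_of_nonneg (by positivity), inv_mul_lt_iff₀ hn']
      linarith
    rw [e] at hnorm ⊢
    rw [hsmul _ _ hnorm, smul_smul]
  have hN : ∀ x : E, ∃ n : ℕ, 0 < n ∧ ‖x‖ < r * n := by
    intro x
    obtain ⟨n, hn⟩ := exists_nat_gt (‖x‖ / r)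
    rw [div_lt_iff₀ hr] at hn
    refine ⟨n, Nat.pos_of_ne_zero ?_, by linarith⟩
    rintro rfl
    simp at hn
    linarith [norm_nonneg x]
  choose N hN0 hNr using hN
  have hA : ∀ (n : ℕ) (x : E), 0 < n → ‖x‖ < r * n →
      (N x : ℝ) • f ((N x : ℝ)⁻¹ • x) = (n : ℝ) • f ((n : ℝ)⁻¹ • x) := by
    intro n x hn hx
    rw [hdiv _ n x (hN0 x) hn (hNr x), hdiv n (N x) x hn (hN0 x) hx, mul_comm]
  let g : E →+ F := AddMonoidHom.mk' (fun x ↦ (N x : ℝ) • f ((N x : ℝ)⁻¹ • x)) (by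
    intro x y
    have hx := hNr x
    have hy := hNr y
    have hxy := norm_add_le x y
    have h0 : 0 < N x + N y := Nat.add_pos_left (hN0 x) _
    have hpos : (0 : ℝ) < (N x + N y : ℕ) := by exact_mod_cast h0
    have hsmall : ∀ z : E, ‖z‖ < r * (N x + N y : ℕ) →
        ‖((N x + N y : ℕ) : ℝ)⁻¹ • z‖ < r := by
      intro z hz
      rw [norm_smul, Real.norm_of_nonneg (by positivity), inv_mul_lt_iff₀ hpos]
      linarith
    have hbx : ‖x‖ < r * (N x + N y : ℕ) := by push_cast; linarith [norm_nonneg y]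
    have hbxy : ‖x + y‖ < r * (N x + N y : ℕ) := by push_cast; linarith
    have hby : ‖y‖ < r * (N x + N y : ℕ) := by push_cast; linarith [norm_nonneg x]
    rw [hA _ x h0 hbx, hA _ y h0 hby, hA _ (x + y) h0 hbxy, ← smul_add,
      ← hadd _ _ (hsmall x hbx) (hsmall y hby), smul_add]
    rw [← smul_add]
    exact hsmall _ hbxy)
  have hg : ∀ u, ‖u‖ < r → g u = f u := by
    intro u hu
    exact (hA 1 u one_pos (by simpa using hu)).trans (by simp)
  have hgc : Continuous g := by
    refine continuous_of_continuousAt_zero g (hf.congr ?_)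
    filter_upwards [Metric.ball_mem_nhds (0 : E) hr] with u hu
    exact (hg u (by simpa using hu)).symm
  exact ⟨g.toRealLinearMap hgc, hg⟩

/-- A continuous map on a product of two copies of a normed space that is a product map along
coordinate lines, and whose coordinate difference depends only on the coordinate difference of the
argument, is locally of the form `(x, y) ↦ (A x + c, A y + d)` with `A` linear. -/
theorem exists_eventuallyEq_affine {E F : Type*}
    [NormedAddCommGroup E] [NormedSpace ℝ E] [NormedAddCommGroup F] [NormedSpace ℝ F]
    {U : Set (E × E)} (hU : IsOpen U) {φ : E × E → F × F} (hφ : ContinuousOn φ U)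
    (h₁ : ∀ p ∈ U, ∀ q ∈ U, p.1 = q.1 → (φ p).1 = (φ q).1)
    (h₂ : ∀ p ∈ U, ∀ q ∈ U, p.2 = q.2 → (φ p).2 = (φ q).2)
    (h₃ : ∀ p ∈ U, ∀ q ∈ U, p.2 - p.1 = q.2 - q.1 → (φ p).2 - (φ p).1 = (φ q).2 - (φ q).1)
    {p : E × E} (hp : p ∈ U) :
    ∃ (A : E →L[ℝ] F) (c d : F), φ =ᶠ[nhds p] fun q ↦ (A q.1 + c, A q.2 + d) := by
  obtain ⟨r, hr, hball⟩ := Metric.isOpen_iff.1 hU p hp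
  have hmem : ∀ u v : E, ‖u‖ < r → ‖v‖ < r → (p.1 + u, p.2 + v) ∈ U := by
    intro u v hu hv
    apply hball
    rw [Metric.mem_ball, Prod.dist_eq, max_lt_iff, dist_eq_norm, dist_eq_norm]
    simp [hu, hv]
  have hr0 : ‖(0 : E)‖ < r := by simpa
  let f : E → F := fun u ↦ (φ (p.1 + u, p.2)).1 - (φ p).1
  have hfst : ∀ u v : E, ‖u‖ < r → ‖v‖ < r → (φ (p.1 + u, p.2 + v)).1 = f u + (φ p).1 := by
    intro u v hu hv
    rw [h₁ _ (hmem u v hu hv) _ (hmem u 0 hu hr0) rfl]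
    simp [f]
  have hsnd : ∀ u v : E, ‖u‖ < r → ‖v‖ < r → (φ (p.1 + u, p.2 + v)).2 = f v + (φ p).2 := by
    intro u v hu hv
    rw [h₂ _ (hmem u v hu hv) _ (hmem v v hv hv) rfl]
    have h := h₃ _ (hmem v v hv hv) p hp (by simp)
    rw [hfst v v hv hv] at h
    rw [sub_eq_iff_eq_add.1 h]
    abel
  have hf : ContinuousAt f 0 := by
    have h : ContinuousAt φ (p.1 + 0, p.2) := by
      simpa using hφ.continuousAt (hU.mem_nhds hp)
    have h' : ContinuousAt (fun u : E ↦ φ (p.1 + u, p.2)) 0 :=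
      ContinuousAt.comp (f := fun u : E ↦ (p.1 + u, p.2)) h (by fun_prop)
    exact h'.fst.sub continuousAt_const
  obtain ⟨A, hA⟩ := exists_continuousLinearMap_eqOn_ball hr hf (by
    intro u v hu hv huv
    have h := h₃ _ (hmem u (u + v) hu huv) _ (hmem 0 v hr0 hv) (by simp only; abel)
    rw [hfst _ _ hu huv, hsnd _ _ hu huv, hfst _ _ hr0 hv, hsnd _ _ hr0 hv] at h
    have h0 : f 0 = 0 := by simp [f]
    rw [h0, sub_eq_iff_eq_add] at h
    have := congrArg (· - (φ p).2) h
    simp only [add_sub_cancel_right] at this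
    rw [this]
    abel)
  refine ⟨A, (φ p).1 - A p.1, (φ p).2 - A p.2, ?_⟩
  filter_upwards [Metric.ball_mem_nhds p hr] with q hq
  rw [Metric.mem_ball, Prod.dist_eq, max_lt_iff, dist_eq_norm, dist_eq_norm] at hq
  have e : q = (p.1 + (q.1 - p.1), p.2 + (q.2 - p.2)) := by simp
  have e₁ := hfst _ _ hq.1 hq.2
  have e₂ := hsnd _ _ hq.1 hq.2
  rw [← e, ← hA _ hq.1, map_sub] at e₁
  rw [← e, ← hA _ hq.2, map_sub] at e₂
  ext1
  · simp only [e₁]; abel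
  · simp only [e₂]; abel

/-- The local affine description of `exists_eventuallyEq_affine` is global on a connected set. -/
theorem exists_eqOn_affine {E F : Type*}
    [NormedAddCommGroup E] [NormedSpace ℝ E] [NormedAddCommGroup F] [NormedSpace ℝ F]
    {U : Set (E × E)} (hU : IsOpen U) (hUc : IsConnected U)
    {φ : E × E → F × F} (hφ : ContinuousOn φ U)
    (h₁ : ∀ p ∈ U, ∀ q ∈ U, p.1 = q.1 → (φ p).1 = (φ q).1)
    (h₂ : ∀ p ∈ U, ∀ q ∈ U, p.2 = q.2 → (φ p).2 = (φ q).2)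
    (h₃ : ∀ p ∈ U, ∀ q ∈ U, p.2 - p.1 = q.2 - q.1 → (φ p).2 - (φ p).1 = (φ q).2 - (φ q).1) :
    ∃ (A : E →L[ℝ] F) (c d : F), ∀ p ∈ U, φ p = (A p.1 + c, A p.2 + d) := by
  have hloc := fun p (hp : p ∈ U) ↦ exists_eventuallyEq_affine hU hφ h₁ h₂ h₃ hp
  have han : ∀ (A : E →L[ℝ] F) (c d : F) (p : E × E),
      AnalyticAt ℝ (fun q : E × E ↦ (A q.1 + c, A q.2 + d)) p := fun A c d p ↦
    (((A.analyticAt _).comp analyticAt_fst).add analyticAt_const).prod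
      (((A.analyticAt _).comp analyticAt_snd).add analyticAt_const)
  obtain ⟨p, hp⟩ := hUc.nonempty
  obtain ⟨A, c, d, h⟩ := hloc p hp
  refine ⟨A, c, d, AnalyticOnNhd.eqOn_of_preconnected_of_eventuallyEq (𝕜 := ℝ) ?_
    (fun q _ ↦ han A c d q) hUc.isPreconnected hp h⟩
  intro q hq
  obtain ⟨A', c', d', h'⟩ := hloc q hq
  exact (han A' c' d' q).congr h'.symm

/-- A real-linear endomorphism of the quaternions that intertwines left multiplication by each of
`i`, `j`, `k` with some left multiplication is a left multiple of an automorphism, or zero. -/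
theorem Quaternion.exists_eq_mul_ringEquiv_or_zero (A : ℍ[ℝ] →ₗ[ℝ] ℍ[ℝ])
    (hA : ∀ q : ℍ[ℝ], q ∈ ({⟨0, 1, 0, 0⟩, ⟨0, 0, 1, 0⟩, ⟨0, 0, 0, 1⟩} : Set ℍ[ℝ]) →
      ∃ m : ℍ[ℝ], ∀ x, A (q * x) = m * A x) :
    ∃ (a : ℍ[ℝ]) (h : ℍ[ℝ] → ℍ[ℝ]), ((∃ e : ℍ[ℝ] ≃+* ℍ[ℝ], h = ⇑e) ∨ h = 0) ∧
      ∀ x, A x = a * h x := by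
  obtain ⟨mi, hi⟩ := hA _ (Or.inl rfl)
  obtain ⟨mj, hj⟩ := hA _ (Or.inr (Or.inl rfl))
  obtain ⟨mk, hk⟩ := hA _ (Or.inr (Or.inr rfl))
  have hmul : ∀ q : ℍ[ℝ], ∃ m : ℍ[ℝ], ∀ x : ℍ[ℝ], A (q * x) = m * A x := by
    intro q
    refine ⟨q.re • 1 + q.imI • mi + q.imJ • mj + q.imK • mk, fun x ↦ ?_⟩
    have e : ∀ I J K : ℍ[ℝ], I = ⟨0, 1, 0, 0⟩ → J = ⟨0, 0, 1, 0⟩ → K = ⟨0, 0, 0, 1⟩ →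
        q * x = q.re • x + q.imI • (I * x) + q.imJ • (J * x) + q.imK • (K * x) := by
      intro I J K hI hJ hK
      ext <;> simp <;> simp [hI, hJ, hK] <;> ring
    rw [e _ _ _ rfl rfl rfl, map_add, map_add, map_add, map_smul, map_smul, map_smul, map_smul,
      hi, hj, hk]
    simp [add_mul]
  by_cases ha : A 1 = 0
  · refine ⟨0, 0, Or.inr rfl, fun x ↦ ?_⟩
    obtain ⟨m, hm⟩ := hmul x
    simpa [ha] using hm 1
  have hprod : ∀ q x, A (q * x) = A q * (A 1)⁻¹ * A x := by
    intro q x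
    obtain ⟨m, hm⟩ := hmul q
    have h1 := hm 1
    rw [mul_one] at h1
    rw [hm, h1, mul_assoc m, mul_inv_cancel₀ ha, mul_one]
  let h : ℍ[ℝ] →+* ℍ[ℝ] :=
    { toFun := fun x ↦ (A 1)⁻¹ * A x
      map_one' := inv_mul_cancel₀ ha
      map_mul' := fun x y ↦ by simp only [hprod x y, mul_assoc]
      map_zero' := by simp
      map_add' := fun x y ↦ by rw [map_add, mul_add] }
  have hh : ∀ x, A x = A 1 * h x := fun x ↦ by
    change A x = A 1 * ((A 1)⁻¹ * A x)
    rw [← mul_assoc, mul_inv_cancel₀ ha, one_mul]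
  have hAinj : Function.Injective A := fun x y hxy ↦ h.injective (by
    change (A 1)⁻¹ * A x = (A 1)⁻¹ * A y
    rw [hxy])
  have hAsurj := LinearMap.injective_iff_surjective.1 hAinj
  have hbij : Function.Bijective h := by
    refine ⟨h.injective, fun y ↦ ?_⟩
    obtain ⟨x, hx⟩ := hAsurj (A 1 * y)
    exact ⟨x, mul_left_cancel₀ ha (by rw [← hh, hx])⟩
  exact ⟨A 1, h, Or.inl ⟨RingEquiv.ofBijective h hbij, rfl⟩, hh⟩

/-- Quaternionic version of the affinity lemma: a continuous map on a connected
open subset of `ℍ²` sending lines parallel to `e₁`, `e₂`, `e₁+e₂` into lines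
parallel to the same vector, and sending lines parallel to `e₁ + q e₂`
(`q ∈ {i,j,k}`) into lines, is of the form
`(x, y) ↦ (a·h(x) + b₁, a·h(y) + b₂)` with `h` a ring automorphism of `ℍ`
or the zero map.  Here a line parallel to `(a₁, a₂) ≠ 0` is a set
`{(a₁ x + b₁, a₂ x + b₂) : x ∈ ℍ}`. -/
theorem quaternion_line_preserving_map_is_twisted_affine
    (U : Set (ℍ[ℝ] × ℍ[ℝ])) (hUopen : IsOpen U) (hUconn : IsConnected U)
    (φ : ℍ[ℝ] × ℍ[ℝ] → ℍ[ℝ] × ℍ[ℝ]) (hcont : ContinuousOn φ U)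
    (hlines : ∀ a : ℍ[ℝ] × ℍ[ℝ], a ∈ ({(1, 0), (0, 1), (1, 1)} : Set (ℍ[ℝ] × ℍ[ℝ])) →
      ∀ b : ℍ[ℝ] × ℍ[ℝ], ∃ c : ℍ[ℝ] × ℍ[ℝ], ∀ p ∈ U,
        (∃ x : ℍ[ℝ], p = (a.1 * x + b.1, a.2 * x + b.2)) →
        ∃ y : ℍ[ℝ], φ p = (a.1 * y + c.1, a.2 * y + c.2))
    (hlines' : ∀ q : ℍ[ℝ],
      q ∈ ({⟨0, 1, 0, 0⟩, ⟨0, 0, 1, 0⟩, ⟨0, 0, 0, 1⟩} : Set ℍ[ℝ]) →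
      ∀ b : ℍ[ℝ] × ℍ[ℝ], ∃ a c : ℍ[ℝ] × ℍ[ℝ], a ≠ 0 ∧ ∀ p ∈ U,
        (∃ x : ℍ[ℝ], p = (x + b.1, q * x + b.2)) →
        ∃ y : ℍ[ℝ], φ p = (a.1 * y + c.1, a.2 * y + c.2)) :
    ∃ (a b₁ b₂ : ℍ[ℝ]) (h : ℍ[ℝ] → ℍ[ℝ]),
      ((∃ e : ℍ[ℝ] ≃+* ℍ[ℝ], h = ⇑e) ∨ h = 0) ∧
      ∀ p ∈ U, φ p = (a * h p.1 + b₁, a * h p.2 + b₂) := by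
  have h₁ : ∀ p ∈ U, ∀ q ∈ U, p.1 = q.1 → (φ p).1 = (φ q).1 := by
    intro p hp q hq hpq
    obtain ⟨c, hc⟩ := hlines (0, 1) (by simp) p
    obtain ⟨y, hy⟩ := hc p hp ⟨0, by simp⟩
    obtain ⟨z, hz⟩ := hc q hq ⟨q.2 - p.2, by ext1 <;> simp [hpq]⟩
    simp [hy, hz]
  have h₂ : ∀ p ∈ U, ∀ q ∈ U, p.2 = q.2 → (φ p).2 = (φ q).2 := by
    intro p hp q hq hpq
    obtain ⟨c, hc⟩ := hlines (1, 0) (by simp) p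
    obtain ⟨y, hy⟩ := hc p hp ⟨0, by simp⟩
    obtain ⟨z, hz⟩ := hc q hq ⟨q.1 - p.1, by ext1 <;> simp [hpq]⟩
    simp [hy, hz]
  have h₃ : ∀ p ∈ U, ∀ q ∈ U, p.2 - p.1 = q.2 - q.1 →
      (φ p).2 - (φ p).1 = (φ q).2 - (φ q).1 := by
    intro p hp q hq hpq
    obtain ⟨c, hc⟩ := hlines (1, 1) (by simp) p
    obtain ⟨y, hy⟩ := hc p hp ⟨0, by simp⟩
    obtain ⟨z, hz⟩ := hc q hq ⟨q.1 - p.1, by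
      ext1
      · simp
      · rw [sub_eq_iff_eq_add] at hpq
        simp only [one_mul, hpq]
        abel⟩
    simp [hy, hz]
  obtain ⟨A, b₁, b₂, hφ⟩ := exists_eqOn_affine hUopen hUconn hcont h₁ h₂ h₃
  have hA : ∀ q : ℍ[ℝ], q ∈ ({⟨0, 1, 0, 0⟩, ⟨0, 0, 1, 0⟩, ⟨0, 0, 0, 1⟩} : Set ℍ[ℝ]) →
      ∃ m : ℍ[ℝ], ∀ x, A (q * x) = m * A x := by
    intro q hq
    obtain ⟨p, hp⟩ := hUconn.nonempty
    obtain ⟨a, c, ha, hc⟩ := hlines' q hq p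
    have hdir : ∀ x, ∃ y, A x = a.1 * y ∧ A (q * x) = a.2 * y := by
      intro x
      have hlim : Filter.Tendsto (fun t : ℝ ↦ (t • x + p.1, q * (t • x) + p.2))
          (nhds 0) (nhds p) := by
        have : Continuous (fun t : ℝ ↦ (t • x + p.1, q * (t • x) + p.2)) := by fun_prop
        simpa using this.tendsto 0
      obtain ⟨t, htU, ht⟩ :=
        (((hlim.eventually (hUopen.mem_nhds hp)).filter_mono nhdsWithin_le_nhds).and
          (self_mem_nhdsWithin : {(0 : ℝ)}ᶜ ∈ nhdsWithin (0 : ℝ) {0}ᶜ)).exists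
      have ht0 : t ≠ 0 := ht
      obtain ⟨y, hy⟩ := hc _ htU ⟨t • x, rfl⟩
      obtain ⟨z, hz⟩ := hc p hp ⟨0, by simp⟩
      rw [hφ _ htU] at hy
      rw [hφ _ hp] at hz
      obtain ⟨hy1, hy2⟩ := Prod.ext_iff.1 hy
      obtain ⟨hz1, hz2⟩ := Prod.ext_iff.1 hz
      simp only [map_add, map_smul, mul_smul_comm] at hy1 hy2 hz1 hz2
      refine ⟨t⁻¹ • (y - z), ?_, ?_⟩
      · rw [mul_smul_comm, eq_inv_smul_iff₀ ht0, mul_sub,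
          eq_sub_of_add_eq hy1.symm, eq_sub_of_add_eq hz1.symm]
        abel
      · rw [mul_smul_comm, eq_inv_smul_iff₀ ht0, mul_sub,
          eq_sub_of_add_eq hy2.symm, eq_sub_of_add_eq hz2.symm]
        abel
    by_cases ha1 : a.1 = 0
    · have h0 : ∀ x, A x = 0 := fun x ↦ by
        obtain ⟨y, hy, -⟩ := hdir x
        simpa [ha1] using hy
      exact ⟨0, fun x ↦ by simp [h0]⟩
    · refine ⟨a.2 * a.1⁻¹, fun x ↦ ?_⟩
      obtain ⟨y, hy, hy'⟩ := hdir x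
      rw [hy, hy', mul_assoc, inv_mul_cancel_left₀ ha1]
  obtain ⟨a, h, hh, hAh⟩ := Quaternion.exists_eq_mul_ringEquiv_or_zero A.toLinearMap hA
  refine ⟨a, b₁, b₂, h, hh, fun p hp ↦ ?_⟩
  rw [hφ p hp, ← hAh, ← hAh]
  rfl
end

section
/- Let n ≥ 2 and let g ∈ GL(n,ℝ) be a lower triangular matrix with all diagonal entries equal to 1. Suppose that for every complete flag (W₁,…,W_{n−1}) in ℝⁿ satisfying W_j ∩ span(e₁,…,e_{n−j}) = {0} for all 1 ≤ j ≤ n−1, the image flag (g·W₁,…,g·W_{n−1}) also satisfies (g·W_j) ∩ span(e₁,…,e_{n−j}) = {0} for all 1 ≤ j ≤ n−1. Then g is the identity matrix. -/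
/-- `W_j^+ = span(e₁, …, e_j)`. -/
def stdIncFlag (n j : ℕ) : Submodule ℝ (Fin n → ℝ) :=
  Submodule.span ℝ {x | ∃ i : Fin n, (i : ℕ) < j ∧ x = Pi.single i 1}

theorem apply_eq_zero_of_mem_stdIncFlag {n m : ℕ} {x : Fin n → ℝ} (hx : x ∈ stdIncFlag n m)
    {a : Fin n} (ha : m ≤ a) : x a = 0 := by
  have hle : stdIncFlag n m ≤ LinearMap.ker (LinearMap.proj (R := ℝ) (φ := fun _ => ℝ) a) := by
    refine Submodule.span_le.2 ?_
    rintro _ ⟨i, hi, rfl⟩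
    have hne : a ≠ i := by
      rintro rfl
      omega
    simp [hne]
  exact hle hx

/-- The transvection `x ↦ x + xᵢ (eᵢ - v)`, which sends `v` to `eᵢ` when `vᵢ = 1`. -/
def straighten {n : ℕ} (i : Fin n) (v : Fin n → ℝ) : (Fin n → ℝ) →ₗ[ℝ] (Fin n → ℝ) :=
  LinearMap.id + (LinearMap.proj i).smulRight (Pi.single i 1 - v)

theorem straighten_apply {n : ℕ} (i : Fin n) (v x : Fin n → ℝ) :
    straighten i v x = x + x i • (Pi.single i 1 - v) := rfl

theorem straighten_surjective {n : ℕ} {i : Fin n} {v : Fin n → ℝ} (hv : v i = 1) :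
    Function.Surjective (straighten i v) := by
  intro y
  refine ⟨y - y i • (Pi.single i 1 - v), ?_⟩
  simp [straighten_apply, hv]

/-- The vectors whose image under `straighten i v` has its first `m` coordinates zero. -/
def straightenedTail {n : ℕ} (i : Fin n) (v : Fin n → ℝ) (m : ℕ) : Submodule ℝ (Fin n → ℝ) :=
  LinearMap.ker
    (LinearMap.funLeft ℝ ℝ (Subtype.val : {a : Fin n // (a : ℕ) < m} → Fin n) ∘ₗ straighten i v)

theorem mem_straightenedTail {n : ℕ} {i : Fin n} {v : Fin n → ℝ} {m : ℕ} {x : Fin n → ℝ} :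
    x ∈ straightenedTail i v m ↔ ∀ a : Fin n, (a : ℕ) < m → straighten i v x a = 0 := by
  simp [straightenedTail, funext_iff, LinearMap.funLeft]

theorem finrank_straightenedTail {n : ℕ} {i : Fin n} {v : Fin n → ℝ} (hv : v i = 1) {m : ℕ}
    (hm : m ≤ n) : Module.finrank ℝ (straightenedTail i v m) = n - m := by
  have hsurj : Function.Surjective
      (LinearMap.funLeft ℝ ℝ (Subtype.val : {a : Fin n // (a : ℕ) < m} → Fin n) ∘ₗ
        straighten i v) :=
    (LinearMap.funLeft_surjective_of_injective ℝ ℝ _ Subtype.val_injective).comp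
      (straighten_surjective hv)
  have hrank := LinearMap.finrank_range_add_finrank_ker
    (LinearMap.funLeft ℝ ℝ (Subtype.val : {a : Fin n // (a : ℕ) < m} → Fin n) ∘ₗ straighten i v)
  rw [LinearMap.range_eq_top.2 hsurj, finrank_top, Module.finrank_fintype_fun_eq_card,
    Module.finrank_fintype_fun_eq_card, Fintype.card_subtype, Fin.card_filter_val_lt,
    Fintype.card_fin, min_eq_right hm] at hrank
  rw [straightenedTail]
  omega

theorem straightenedTail_antitone {n : ℕ} (i : Fin n) (v : Fin n → ℝ) :
    Antitone (straightenedTail i v) := fun _ _ h _ hx =>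
  mem_straightenedTail.2 fun a ha => mem_straightenedTail.1 hx a (ha.trans_le h)

theorem straightenedTail_inf_stdIncFlag {n : ℕ} {i : Fin n} {v : Fin n → ℝ} (hv : v i = 1)
    (m : ℕ) : straightenedTail i v m ⊓ stdIncFlag n m = ⊥ := by
  refine (Submodule.eq_bot_iff _).2 ?_
  rintro x ⟨hxW, hxE⟩
  rw [SetLike.mem_coe, mem_straightenedTail] at hxW
  have hxi : x i = 0 := by
    rcases lt_or_ge (i : ℕ) m with hi | hi
    · simpa [straighten_apply, hv] using hxW i hi
    · exact apply_eq_zero_of_mem_stdIncFlag hxE hi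
  ext a
  rcases lt_or_ge (a : ℕ) m with ha | ha
  · simpa [straighten_apply, hxi] using hxW a ha
  · exact apply_eq_zero_of_mem_stdIncFlag hxE ha

theorem self_mem_straightenedTail {n : ℕ} {i : Fin n} {v : Fin n → ℝ} (hv : v i = 1) {m : ℕ}
    (hi : m ≤ i) : v ∈ straightenedTail i v m := by
  refine mem_straightenedTail.2 fun a ha => ?_
  have hne : a ≠ i := by
    rintro rfl
    omega
  simp [straighten_apply, hv, hne]

/-- If a lower unitriangular `g ∈ GL(n,ℝ)` maps every complete flag transverse
to the standard increasing flag to a flag which is again transverse to the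
standard increasing flag, then `g` is the identity. -/
theorem lower_unitriangular_preserving_transverse_flags_is_id
    (n : ℕ) (hn : 2 ≤ n) (g : Matrix (Fin n) (Fin n) ℝ) (hg : IsUnit g)
    (hdiag : ∀ i : Fin n, g i i = 1)
    (hlower : ∀ i j : Fin n, i < j → g i j = 0)
    (hpres : ∀ W : ℕ → Submodule ℝ (Fin n → ℝ),
      (∀ j : ℕ, 1 ≤ j → j ≤ n - 1 → Module.finrank ℝ (W j) = j) →
      (∀ j : ℕ, 1 ≤ j → j + 1 ≤ n - 1 → W j ≤ W (j + 1)) →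
      (∀ j : ℕ, 1 ≤ j → j ≤ n - 1 → W j ⊓ stdIncFlag n (n - j) = ⊥) →
      (∀ j : ℕ, 1 ≤ j → j ≤ n - 1 →
        (Submodule.map g.mulVecLin (W j)) ⊓ stdIncFlag n (n - j) = ⊥)) :
    g = 1 := by
  have hdet : IsUnit g.det := (Matrix.isUnit_iff_isUnit_det g).1 hg
  have hinv : g⁻¹.BlockTriangular id := by
    intro i k hki
    by_contra hne
    have hki' : (k : ℕ) < i := hki
    have hin := i.isLt
    set v : Fin n → ℝ := (g⁻¹ i k)⁻¹ • g⁻¹.col k with hvdef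
    have hv : v i = 1 := by simp [hvdef, hne]
    have hgv : g.mulVecLin v = (g⁻¹ i k)⁻¹ • Pi.single k 1 := by
      rw [hvdef, map_smul, Matrix.mulVecLin_apply, ← Matrix.mulVec_single_one,
        Matrix.mulVec_mulVec, Matrix.mul_nonsing_inv g hdet, Matrix.one_mulVec]
    have htrans := hpres (fun j => straightenedTail i v (n - j))
      (fun j _ hj => by
        rw [finrank_straightenedTail hv (Nat.sub_le n j)]
        omega)
      (fun j _ _ => straightenedTail_antitone i v (by omega))
      (fun j _ _ => straightenedTail_inf_stdIncFlag hv (n - j))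
      (n - (k + 1)) (by omega) (by omega)
    have hzero : g.mulVecLin v = 0 := by
      rw [← Submodule.mem_bot ℝ, ← htrans]
      refine ⟨Submodule.mem_map_of_mem (self_mem_straightenedTail hv (by omega)), ?_⟩
      rw [hgv]
      exact Submodule.smul_mem _ _ (Submodule.subset_span ⟨k, by omega, rfl⟩)
    have hk := congrFun (hgv.symm.trans hzero) k
    simp [hne] at hk
  have hupper : g.BlockTriangular id := by
    have : Invertible g⁻¹ := (Matrix.isUnit_nonsing_inv_iff.2 hg).invertible
    simpa [Matrix.nonsing_inv_nonsing_inv g hdet] using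
      Matrix.blockTriangular_inv_of_blockTriangular hinv
  ext i j
  rcases lt_trichotomy i j with h | rfl | h
  · rw [hlower i j h, Matrix.one_apply_ne h.ne]
  · rw [hdiag, Matrix.one_apply_eq]
  · rw [hupper h, Matrix.one_apply_ne h.ne']
end
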